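/- Let F be a finite index set, α, v : F → ℝ, and d ∈ ℝ. Assume d < 0 and d + Σ_{j∈S} v_j < 0 for every nonempty subset S ⊆ F. Then ∫_{0}^{∞} e^{d y} · ∏_{j∈F} (1 + e^{α_j + v_j y}) dy = −1/d − Σ_{∅≠S⊆F} e^{Σ_{j∈S} α_j} / (d + Σ_{j∈S} v_j). -/

import Mathlib

open Finset Real MeasureTheory

/-- Expansion of `e^{dy} ∏_{j∈F} (1 + e^{α_j + v_j y})` as a sum of exponentials. -/
theorem exp_mul_prod_one_add_exp {ι : Type*} (F : Finset ι) (α v : ι → ℝ) (d y : ℝ) :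
    Real.exp (d * y) * ∏ j ∈ F, (1 + Real.exp (α j + v j * y))
      = ∑ S ∈ F.powerset,
          Real.exp (∑ j ∈ S, α j) * Real.exp ((d + ∑ j ∈ S, v j) * y) := by
  rw [Finset.prod_one_add, Finset.mul_sum]
  refine Finset.sum_congr rfl fun S _ => ?_
  rw [← Real.exp_sum, ← Real.exp_add, ← Real.exp_add, Finset.sum_add_distrib, ← Finset.sum_mul]
  ring_nf

/-- Normalizing integral on `[0,∞)` of the RBM conditional density:
`∫_0^∞ e^{dy} ∏_{j∈F} (1 + e^{α_j + v_j y}) dy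
  = −1/d − Σ_{∅≠S⊆F} e^{Σ_{j∈S} α_j} / (d + Σ_{j∈S} v_j)`. -/
theorem integral_half_line_exp_prod {ι : Type*} [DecidableEq ι]
    (F : Finset ι) (α v : ι → ℝ) (d : ℝ) (hd : d < 0)
    (hdv : ∀ S ∈ F.powerset, S.Nonempty → d + ∑ j ∈ S, v j < 0) :
    ∫ y in Set.Ioi (0 : ℝ), Real.exp (d * y) * ∏ j ∈ F, (1 + Real.exp (α j + v j * y))
      = -1 / d
        - ∑ S ∈ F.powerset.filter (fun S => S.Nonempty),
            Real.exp (∑ j ∈ S, α j) / (d + ∑ j ∈ S, v j) := by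
  have hneg : ∀ S ∈ F.powerset, d + ∑ j ∈ S, v j < 0 := by
    intro S hS
    rcases S.eq_empty_or_nonempty with rfl | hne
    · simpa using hd
    · exact hdv S hS hne
  have hfilter : F.powerset.filter (fun S => S.Nonempty) = F.powerset.erase ∅ := by
    ext S
    simp [Finset.nonempty_iff_ne_empty, and_comm]
  simp_rw [exp_mul_prod_one_add_exp]
  rw [integral_finsetSum _ fun S hS => (integrableOn_exp_mul_Ioi (hneg S hS) 0).const_mul _,
    hfilter, ← Finset.add_sum_erase _ _ (Finset.empty_mem_powerset F), sub_eq_add_neg,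
    ← Finset.sum_neg_distrib]
  congr 1
  · simp [integral_exp_mul_Ioi hd]
  · refine Finset.sum_congr rfl fun S hS => ?_
    rw [integral_const_mul, integral_exp_mul_Ioi (hneg S (Finset.mem_of_mem_erase hS)),
      mul_zero, Real.exp_zero]
    ring
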